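/- arXiv:1511.06082 — 2 statements merged into one kernel-verified Lean document; each statement's English description precedes it below -/
import Mathlib

section
/- For all real μ ≥ ν > 0 and all x > 0, K_ν(x) I_μ(x) ≤ 2 π^{3/2} c_L / (√3 · Γ(2/3) Γ(5/6) (2x)^{1/3}), where c_L = sup_{t ≥ 0} t^{1/3} J_0(t) ≈ 0.7857468704. -/
open Real MeasureTheory Set Filter

/-- Modified Bessel function of the first kind `I_ν`. -/
noncomputable def besselI (ν x : ℝ) : ℝ :=
  ∑' n : ℕ, (x / 2) ^ (2 * (n : ℝ) + ν) / ((n.factorial : ℝ) * Real.Gamma ((n : ℝ) + ν + 1))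

/-- Modified Bessel function of the second kind `K_ν`. -/
noncomputable def besselK (ν x : ℝ) : ℝ :=
  ∫ t in Ioi (0 : ℝ), Real.exp (-x * Real.cosh t) * Real.cosh (ν * t)

/-- Bessel function of the first kind `J_ν`. -/
noncomputable def besselJ (ν x : ℝ) : ℝ :=
  ∑' n : ℕ, (-1 : ℝ) ^ n * (x / 2) ^ (2 * (n : ℝ) + ν) /
    ((n.factorial : ℝ) * Real.Gamma ((n : ℝ) + ν + 1))

/-- Modified Struve function of the first kind `L_ν`. -/
noncomputable def struveL (ν x : ℝ) : ℝ :=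
  ∑' n : ℕ, (x / 2) ^ (2 * (n : ℝ) + ν + 1) /
    (Real.Gamma ((n : ℝ) + 3 / 2) * Real.Gamma ((n : ℝ) + ν + 3 / 2))

/-- Airy function `Ai`. -/
noncomputable def airyAi (t : ℝ) : ℝ :=
  (1 / Real.pi) * ∫ s in Ioi (0 : ℝ), Real.cos (s ^ 3 / 3 + s * t)

/-- Landau constant `b_L = 2^{1/3} ⬝ sup_{t ≥ 0} Ai(t)`. -/
noncomputable def landau_bL : ℝ :=
  (2 : ℝ) ^ ((1 : ℝ) / 3) * sSup (airyAi '' Ici 0)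

/-- Landau constant `c_L = sup_{t ≥ 0} t^{1/3} J₀(t)`. -/
noncomputable def landau_cL : ℝ :=
  sSup ((fun t : ℝ => t ^ ((1 : ℝ) / 3) * besselJ 0 t) '' Ici 0)

lemma Gamma_three_halves : Real.Gamma (3 / 2) = √Real.pi / 2 := by
  rw [show (3 / 2 : ℝ) = 1 / 2 + 1 by norm_num, Real.Gamma_add_one (by norm_num),
    Real.Gamma_one_half_eq]
  ring

lemma pi_div_four_le_of_sqrt_le_rpow {g θ : ℝ} (hg : 0 < g) (hθ : 1 / 2 ≤ θ)
    (h : √Real.pi / 2 ≤ g ^ θ) : Real.pi / 4 ≤ g := by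
  rcases le_or_gt 1 g with h1 | h1
  · linarith [Real.pi_lt_four]
  · have h2 : √Real.pi / 2 ≤ √g := by
      rw [Real.sqrt_eq_rpow g]
      exact h.trans (Real.rpow_le_rpow_of_exponent_ge hg h1.le hθ)
    have h3 := mul_self_le_mul_self (by positivity) h2
    rw [Real.mul_self_sqrt hg.le] at h3
    nlinarith [Real.mul_self_sqrt Real.pi_pos.le]

lemma pi_div_four_le_Gamma_add_one {s : ℝ} (hs : 0 ≤ s) (hs1 : s ≤ 1) :
    Real.pi / 4 ≤ Real.Gamma (s + 1) := by
  have hg : 0 < Real.Gamma (s + 1) := Real.Gamma_pos_of_pos (by linarith)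
  rcases lt_trichotomy s (1 / 2) with h | h | h
  · have h1 : 0 < 1 - s := by linarith
    refine pi_div_four_le_of_sqrt_le_rpow (θ := 1 / (2 * (1 - s))) hg ?_ ?_
    · rw [div_le_div_iff₀ (by norm_num) (by positivity)]; linarith
    · have hb : 0 < 1 - 1 / (2 * (1 - s)) := by
        rw [sub_pos, div_lt_one (by positivity)]; linarith
      have := Real.Gamma_mul_add_mul_le_rpow_Gamma_mul_rpow_Gamma (s := s + 1) (t := 2)
        (a := 1 / (2 * (1 - s))) (by linarith) (by norm_num) (by positivity) hb (by ring)
      rw [show 1 / (2 * (1 - s)) * (s + 1) + (1 - 1 / (2 * (1 - s))) * 2 = 3 / 2 by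
        field_simp; ring, Gamma_three_halves, Real.Gamma_two, Real.one_rpow, mul_one] at this
      exact this
  · refine pi_div_four_le_of_sqrt_le_rpow (θ := 1) hg (by norm_num) ?_
    rw [h, Real.rpow_one, show (1 / 2 + 1 : ℝ) = 3 / 2 by norm_num, Gamma_three_halves]
  · refine pi_div_four_le_of_sqrt_le_rpow (θ := 1 / (2 * s)) hg ?_ ?_
    · rw [div_le_div_iff₀ (by norm_num) (by positivity)]; linarith
    · have h0 : 0 < s := by linarith
      have hb : 0 < 1 - 1 / (2 * s) := by
        rw [sub_pos, div_lt_one (by positivity)]; linarith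
      have := Real.Gamma_mul_add_mul_le_rpow_Gamma_mul_rpow_Gamma (s := s + 1) (t := 1)
        (a := 1 / (2 * s)) (by linarith) (by norm_num) (by positivity) hb (by ring)
      rw [show 1 / (2 * s) * (s + 1) + (1 - 1 / (2 * s)) * 1 = 3 / 2 by
        field_simp; ring, Gamma_three_halves, Real.Gamma_one, Real.one_rpow, mul_one] at this
      exact this

lemma rpow_mul_exp_neg_le {r y : ℝ} (hr : 0 < r) (hy : 0 < y) :
    r ^ y * Real.exp (-r) ≤ y ^ y * Real.exp (-y) := by
  rw [Real.rpow_def_of_pos hr, Real.rpow_def_of_pos hy, ← Real.exp_add, ← Real.exp_add,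
    Real.exp_le_exp]
  have h := Real.log_le_sub_one_of_pos (div_pos hr hy)
  rw [Real.log_div hr.ne' hy.ne'] at h
  have h2 : y * (Real.log r - Real.log y) ≤ y * (r / y - 1) :=
    mul_le_mul_of_nonneg_left h hy.le
  have h3 : y * (r / y - 1) = r - y := by field_simp
  linarith

lemma log_le_half_sub_inv {x : ℝ} (hx : 1 ≤ x) : Real.log x ≤ (x - x⁻¹) / 2 := by
  rw [← Real.sinh_log (by linarith)]
  exact Real.self_le_sinh_iff.2 (Real.log_nonneg hx)

lemma add_one_rpow_mul_exp_neg_le {y : ℝ} (hy : 0 < y) :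
    (y + 1) ^ (y + 1) * Real.exp (-(y + 1)) ≤ (y + 2 / 3) * (y ^ y * Real.exp (-y)) := by
  have h23 : 0 < y + 2 / 3 := by linarith
  have hy1 : 0 < y + 1 := by linarith
  rw [← Real.exp_log h23, Real.rpow_def_of_pos hy, Real.rpow_def_of_pos hy1, ← Real.exp_add,
    ← Real.exp_add, ← Real.exp_add, Real.exp_le_exp]
  have h1 := log_le_half_sub_inv (x := (y + 1) / y) (by rw [le_div_iff₀ hy]; linarith)
  have h2 := Real.log_le_sub_one_of_pos (div_pos hy1 h23)
  rw [Real.log_div hy1.ne' hy.ne'] at h1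
  rw [Real.log_div hy1.ne' h23.ne'] at h2
  have h3 := mul_le_mul_of_nonneg_left h1 hy.le
  have h4 : y * (((y + 1) / y - ((y + 1) / y)⁻¹) / 2) = 1 - 1 / (2 * y + 2) := by
    field_simp; ring
  have h5 : (y + 1) / (y + 2 / 3) - 1 = 1 / (3 * y + 2) := by
    field_simp; ring
  have h6 : 1 / (3 * y + 2) ≤ 1 / (2 * y + 2) :=
    one_div_le_one_div_of_le (by linarith) (by linarith)
  linarith

lemma rpow_add_third_le_half_exp {r s : ℝ} (hr : 0 < r) (hs : 0 ≤ s) (hs1 : s ≤ 1) :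
    r ^ (s + 1 / 3) ≤ Real.exp r / 2 := by
  have he : (2.7182818283 : ℝ) < Real.exp 1 := Real.exp_one_gt_d9
  rcases le_or_gt r 1 with h | h
  · refine (Real.rpow_le_rpow_of_exponent_ge hr h (by linarith : (1 / 3 : ℝ) ≤ s + 1 / 3)).trans ?_
    have h1 : Real.exp (3 * r) = Real.exp 1 * Real.exp (3 * r - 1) := by
      rw [← Real.exp_add]; ring_nf
    have h2 : 3 * r ≤ Real.exp (3 * r - 1) := by linarith [Real.add_one_le_exp (3 * r - 1)]
    have h3 : r ≤ (Real.exp r / 2) ^ 3 := by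
      have : (Real.exp r / 2) ^ 3 = Real.exp (3 * r) / 8 := by
        rw [div_pow, ← Real.exp_nat_mul]; norm_num
      rw [this, h1]
      nlinarith
    calc r ^ (1 / 3 : ℝ) ≤ ((Real.exp r / 2) ^ 3) ^ (1 / 3 : ℝ) :=
          Real.rpow_le_rpow hr.le h3 (by norm_num)
      _ = Real.exp r / 2 := by
          rw [← Real.rpow_natCast, ← Real.rpow_mul (by positivity)]; norm_num
  · refine (Real.rpow_le_rpow_of_exponent_le h.le
      (by linarith : s + 1 / 3 ≤ (4 / 3 : ℝ))).trans ?_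
    have h1 : Real.exp (3 / 4 * r) = Real.exp 1 * Real.exp (3 / 4 * r - 1) := by
      rw [← Real.exp_add]; ring_nf
    have h2 : 3 / 4 * r ≤ Real.exp (3 / 4 * r - 1) := by
      linarith [Real.add_one_le_exp (3 / 4 * r - 1)]
    have h3 : r ^ 4 ≤ (Real.exp r / 2) ^ 3 := by
      have : (Real.exp r / 2) ^ 3 = Real.exp (3 / 4 * r) ^ 4 / 8 := by
        rw [div_pow, ← Real.exp_nat_mul, ← Real.exp_nat_mul]; norm_num; ring_nf
      have h4 : 2 * r ≤ Real.exp (3 / 4 * r) := by rw [h1]; nlinarith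
      have h5 := pow_le_pow_left₀ (by positivity) h4 4
      rw [this]
      nlinarith [pow_pos hr 4]
    calc r ^ (4 / 3 : ℝ) = (r ^ 4) ^ (1 / 3 : ℝ) := by
          rw [← Real.rpow_natCast, ← Real.rpow_mul hr.le]; norm_num
      _ ≤ ((Real.exp r / 2) ^ 3) ^ (1 / 3 : ℝ) :=
          Real.rpow_le_rpow (by positivity) h3 (by norm_num)
      _ = Real.exp r / 2 := by
          rw [← Real.rpow_natCast, ← Real.rpow_mul (by positivity)]; norm_num

/-- A Stirling-type lower bound for the Gamma function, uniform in `r`. -/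
lemma rpow_mul_exp_neg_le_Gamma {s r : ℝ} (hs : 0 ≤ s) (hr : 0 < r) :
    r ^ (s + 1 / 3) * Real.exp (-r) ≤ 2 / Real.pi * Real.Gamma (s + 1) := by
  suffices H : ∀ n : ℕ, ∀ s r : ℝ, 0 ≤ s → s ≤ n + 1 → 0 < r →
      r ^ (s + 1 / 3) * Real.exp (-r) ≤ 2 / Real.pi * Real.Gamma (s + 1) by
    obtain ⟨n, hn⟩ := exists_nat_ge s
    exact H n s r hs (by linarith) hr
  intro n
  have base : ∀ s r : ℝ, 0 ≤ s → s ≤ 1 → 0 < r →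
      r ^ (s + 1 / 3) * Real.exp (-r) ≤ 2 / Real.pi * Real.Gamma (s + 1) := by
    intro s r hs hs1 hr
    have h1 := pi_div_four_le_Gamma_add_one hs hs1
    have h2 : r ^ (s + 1 / 3) * Real.exp (-r) ≤ 1 / 2 := by
      rw [Real.exp_neg, ← div_eq_mul_inv, div_le_iff₀ (Real.exp_pos r)]
      linarith [rpow_add_third_le_half_exp hr hs hs1]
    have h3 : (1 / 2 : ℝ) = 2 / Real.pi * (Real.pi / 4) := by
      field_simp [Real.pi_ne_zero]; norm_num
    rw [h3] at h2
    exact h2.trans (mul_le_mul_of_nonneg_left h1 (by positivity))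
  induction n with
  | zero => intro s r hs hs1 hr; exact base s r hs (by simpa using hs1) hr
  | succ n ih =>
    intro s r hs hs1 hr
    rcases le_or_gt s 1 with h | h
    · exact base s r hs h hr
    · push_cast at hs1
      have hy : 0 < s - 1 + 1 / 3 := by linarith
      have h1 := ih (s - 1) (s - 1 + 1 / 3) (by linarith) (by linarith) hy
      have h2 := add_one_rpow_mul_exp_neg_le hy
      have h3 := rpow_mul_exp_neg_le hr (y := s + 1 / 3) (by linarith)
      rw [show s - 1 + 1 / 3 + 1 = s + 1 / 3 by ring,
        show s - 1 + 1 / 3 + 2 / 3 = s by ring] at h2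
      rw [Real.Gamma_add_one (by linarith)]
      rw [show s - 1 + 1 = s by ring] at h1
      calc _ ≤ _ := h3
        _ ≤ _ := h2
        _ ≤ s * (2 / Real.pi * Real.Gamma s) := mul_le_mul_of_nonneg_left h1 hs
        _ = _ := by ring

lemma besselI_nonneg {μ x : ℝ} (hμ : 0 < μ) (hx : 0 < x) : 0 ≤ besselI μ x :=
  tsum_nonneg fun n => by
    have : 0 < Real.Gamma ((n : ℝ) + μ + 1) := Real.Gamma_pos_of_pos (by positivity)
    positivity

lemma besselI_le {μ x : ℝ} (hμ : 0 < μ) (hx : 0 < x) (t : ℝ) :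
    besselI μ x ≤ 2 / Real.pi * (x / 2 * Real.exp t) ^ (-(1 / 3) : ℝ) *
      Real.exp (x * Real.cosh t) * Real.exp (-(μ * t)) := by
  set r := x / 2 * Real.exp t with hr
  set q := x / 2 * Real.exp (-t) with hq
  have hr0 : 0 < r := by positivity
  have hq0 : 0 < q := by positivity
  have hqr : q * r = (x / 2) ^ 2 := by
    have : Real.exp (-t) * Real.exp t = 1 := by rw [← Real.exp_add]; simp
    rw [hq, hr]; linear_combination (x / 2) ^ 2 * this
  have hsum : x * Real.cosh t = q + r := by rw [Real.cosh_eq, hq, hr]; ring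
  have hrμ : r ^ μ = (x / 2) ^ μ * Real.exp (μ * t) := by
    rw [hr, Real.mul_rpow (by positivity) (by positivity), ← Real.exp_mul, mul_comm t]
  set c := 2 / Real.pi * r ^ (-(1 / 3) : ℝ) * Real.exp r * Real.exp (-(μ * t)) with hc
  have hc0 : 0 ≤ c := by positivity
  have hterm : ∀ n : ℕ, (x / 2) ^ (2 * (n : ℝ) + μ) /
      ((n.factorial : ℝ) * Real.Gamma ((n : ℝ) + μ + 1)) ≤ c * (q ^ n / n.factorial) := by
    intro n
    have hG : 0 < Real.Gamma ((n : ℝ) + μ + 1) := Real.Gamma_pos_of_pos (by positivity)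
    have h1 := rpow_mul_exp_neg_le_Gamma (s := n + μ) (by positivity) hr0
    have h2 : (x / 2) ^ (2 * (n : ℝ) + μ) = q ^ n * r ^ n * r ^ μ * Real.exp (-(μ * t)) := by
      rw [← mul_pow, hqr, hrμ, Real.rpow_add (by positivity), ← pow_mul,
        ← Real.rpow_natCast (x / 2), mul_assoc, mul_assoc, ← Real.exp_add]
      simp
    have h3 : r ^ n * r ^ μ = r ^ ((n : ℝ) + μ + 1 / 3) * r ^ (-(1 / 3) : ℝ) := by
      rw [← Real.rpow_natCast, ← Real.rpow_add hr0, ← Real.rpow_add hr0]; ring_nf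
    have h4 : r ^ ((n : ℝ) + μ + 1 / 3) ≤
        2 / Real.pi * Real.Gamma (n + μ + 1) * Real.exp r := by
      rwa [Real.exp_neg, ← div_eq_mul_inv, div_le_iff₀ (Real.exp_pos r)] at h1
    rw [h2, mul_assoc (q ^ n), h3, div_le_iff₀ (by positivity)]
    calc _ = r ^ ((n : ℝ) + μ + 1 / 3) *
          (q ^ n * r ^ (-(1 / 3) : ℝ) * Real.exp (-(μ * t))) := by ring
      _ ≤ 2 / Real.pi * Real.Gamma (n + μ + 1) * Real.exp r *
          (q ^ n * r ^ (-(1 / 3) : ℝ) * Real.exp (-(μ * t))) := by gcongr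
      _ = _ := by rw [hc]; field_simp
  have hexp : 2 / Real.pi * r ^ (-(1 / 3) : ℝ) * Real.exp (x * Real.cosh t) *
      Real.exp (-(μ * t)) = c * Real.exp q := by
    rw [hsum, Real.exp_add, hc]; ring
  rw [hexp]
  refine Real.tsum_le_of_sum_range_le (fun n => ?_) fun n => ?_
  · have : 0 < Real.Gamma ((n : ℝ) + μ + 1) := Real.Gamma_pos_of_pos (by positivity)
    positivity
  · refine (Finset.sum_le_sum fun i _ => hterm i).trans ?_
    rw [← Finset.mul_sum]
    exact mul_le_mul_of_nonneg_left (Real.sum_le_exp_of_nonneg hq0.le n) hc0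

lemma besselK_mul_besselI_le {μ ν x : ℝ} (hμν : ν ≤ μ) (hν : 0 < ν) (hx : 0 < x) :
    besselK ν x * besselI μ x ≤ 6 / Real.pi * (x / 2) ^ (-(1 / 3) : ℝ) := by
  have hμ : 0 < μ := hν.trans_le hμν
  rw [besselK, ← integral_mul_const]
  have hint : ∫ t in Ioi (0 : ℝ), 2 / Real.pi * (x / 2) ^ (-(1 / 3) : ℝ) *
      Real.exp (-(1 / 3) * t) = 6 / Real.pi * (x / 2) ^ (-(1 / 3) : ℝ) := by
    rw [integral_const_mul, integral_exp_mul_Ioi (by norm_num)]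
    simp; ring
  rw [← hint]
  refine integral_mono_of_nonneg ?_ ?_ ?_
  · refine Filter.Eventually.of_forall fun t => ?_
    have := besselI_nonneg hμ hx
    have := Real.cosh_pos (ν * t)
    simp only [Pi.zero_apply]
    positivity
  · exact (integrableOn_exp_mul_Ioi (by norm_num) 0).const_mul _
  · refine (ae_restrict_iff' measurableSet_Ioi).2 (Filter.Eventually.of_forall fun t ht => ?_)
    have ht0 : 0 < t := ht
    have hcosh : Real.cosh (ν * t) ≤ Real.exp (μ * t) := by
      have h1 : Real.exp (-(ν * t)) ≤ Real.exp (ν * t) :=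
        Real.exp_le_exp.2 (by nlinarith [mul_pos hν ht0])
      have h2 : Real.exp (ν * t) ≤ Real.exp (μ * t) :=
        Real.exp_le_exp.2 (mul_le_mul_of_nonneg_right hμν ht0.le)
      rw [Real.cosh_eq]; linarith
    have hI := besselI_le hμ hx t
    calc Real.exp (-x * Real.cosh t) * Real.cosh (ν * t) * besselI μ x
        ≤ Real.exp (-x * Real.cosh t) * Real.exp (μ * t) *
          (2 / Real.pi * (x / 2 * Real.exp t) ^ (-(1 / 3) : ℝ) *
            Real.exp (x * Real.cosh t) * Real.exp (-(μ * t))) := by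
          gcongr
          exact besselI_nonneg hμ hx
      _ = 2 / Real.pi * (x / 2 * Real.exp t) ^ (-(1 / 3) : ℝ) := by
          have h1 : Real.exp (-x * Real.cosh t) * Real.exp (x * Real.cosh t) = 1 := by
            rw [← Real.exp_add]; simp
          have h2 : Real.exp (μ * t) * Real.exp (-(μ * t)) = 1 := by
            rw [← Real.exp_add]; simp
          linear_combination (2 / Real.pi * (x / 2 * Real.exp t) ^ (-(1 / 3) : ℝ)) *
            (Real.exp (μ * t) * Real.exp (-(μ * t)) * h1 + h2)
      _ = _ := by
          rw [Real.mul_rpow (by positivity) (by positivity), ← Real.exp_mul]; ring_nf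

lemma Gamma_two_thirds_mul_Gamma_five_sixths_le :
    Real.Gamma (2 / 3) * Real.Gamma (5 / 6) ≤ 9 / 10 * √Real.pi := by
  have h1 := Real.Gamma_mul_add_mul_le_rpow_Gamma_mul_rpow_Gamma (s := 3 / 2) (t := 2)
    (a := 2 / 3) (b := 1 / 3) (by norm_num) (by norm_num) (by norm_num) (by norm_num) (by norm_num)
  have h2 := Real.Gamma_mul_add_mul_le_rpow_Gamma_mul_rpow_Gamma (s := 3 / 2) (t := 2)
    (a := 1 / 3) (b := 2 / 3) (by norm_num) (by norm_num) (by norm_num) (by norm_num) (by norm_num)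
  rw [Real.Gamma_two, Real.one_rpow, mul_one,
    show (2 / 3 * (3 / 2) + 1 / 3 * 2 : ℝ) = 2 / 3 + 1 by norm_num,
    Real.Gamma_add_one (by norm_num)] at h1
  rw [Real.Gamma_two, Real.one_rpow, mul_one,
    show (1 / 3 * (3 / 2) + 2 / 3 * 2 : ℝ) = 5 / 6 + 1 by norm_num,
    Real.Gamma_add_one (by norm_num)] at h2
  have hG : 0 < Real.Gamma (3 / 2) := Real.Gamma_pos_of_pos (by norm_num)
  have h3 : Real.Gamma (3 / 2) ^ (2 / 3 : ℝ) * Real.Gamma (3 / 2) ^ (1 / 3 : ℝ) =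
      √Real.pi / 2 := by
    rw [← Real.rpow_add hG, ← Gamma_three_halves]; norm_num
  have h5 : 0 < Real.Gamma (5 / 6) := Real.Gamma_pos_of_pos (by norm_num)
  have h4 := mul_le_mul h1 h2 (by positivity) (by positivity)
  rw [h3] at h4
  linarith

/-- The entire function `∑ (-s)^n / (n! (n + k)!)`; `k = 0` gives `J₀(2√s)`. -/
noncomputable def besselClifford (k : ℕ) (s : ℝ) : ℝ :=
  ∑' n : ℕ, (-1) ^ n * s ^ n / ((n.factorial : ℝ) * (n + k).factorial)

lemma norm_besselClifford_term_le (k n : ℕ) (s : ℝ) :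
    ‖(-1) ^ n * s ^ n / ((n.factorial : ℝ) * (n + k).factorial)‖ ≤ |s| ^ n / n.factorial := by
  have h1 : (1 : ℝ) ≤ (n + k).factorial := by exact_mod_cast (n + k).factorial_pos
  have h2 : (0 : ℝ) < n.factorial := by exact_mod_cast n.factorial_pos
  rw [norm_div, norm_mul, norm_pow, norm_pow, norm_neg, norm_one, one_pow, one_mul,
    Real.norm_eq_abs, Real.norm_of_nonneg (by positivity)]
  gcongr
  nlinarith

lemma summable_besselClifford (k : ℕ) (s : ℝ) :
    Summable fun n : ℕ => (-1) ^ n * s ^ n / ((n.factorial : ℝ) * (n + k).factorial) :=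
  Summable.of_norm_bounded (Real.summable_pow_div_factorial |s|)
    fun n => norm_besselClifford_term_le k n s

lemma hasDerivAt_besselClifford (k : ℕ) (s : ℝ) :
    HasDerivAt (besselClifford k) (-besselClifford (k + 1) s) s := by
  set R := |s| + 1 with hR
  set g' : ℕ → ℝ → ℝ := fun n y =>
    (-1) ^ n * (n * y ^ (n - 1)) / ((n.factorial : ℝ) * (n + k).factorial) with hg'
  have hsucc : ∀ (n : ℕ) (y : ℝ), g' (n + 1) y =
      -((-1) ^ n * y ^ n / ((n.factorial : ℝ) * (n + (k + 1)).factorial)) := by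
    intro n y
    have h1 : ((n + 1 : ℕ) : ℝ) ≠ 0 := by positivity
    simp only [hg', Nat.add_sub_cancel, Nat.factorial_succ n, show n + 1 + k = n + (k + 1) by ring]
    push_cast at h1 ⊢
    field_simp
    ring
  have hzero : ∀ y, g' 0 y = 0 := fun y => by simp [hg']
  have hs : s ∈ Metric.ball (0 : ℝ) R := by simp [hR]
  have key := hasDerivAt_tsum_of_isPreconnected
    (g := fun (n : ℕ) (y : ℝ) => (-1) ^ n * y ^ n / ((n.factorial : ℝ) * (n + k).factorial))
    (g' := g') (u := fun n => if n = 0 then 0 else R ^ (n - 1) / (n - 1).factorial)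
    (t := Metric.ball (0 : ℝ) R) (y₀ := s) (y := s) ?_ Metric.isOpen_ball
    (convex_ball _ _).isPreconnected ?_ ?_ hs (summable_besselClifford k s) hs
  · refine HasDerivAt.congr_deriv (f := besselClifford k) key ?_
    have hsum : Summable fun n => g' (n + 1) s := by
      simp only [hsucc]
      exact (summable_besselClifford (k + 1) s).neg
    have hsum' : Summable fun n => g' n s :=
      (summable_nat_add_iff (f := fun n => g' n s) 1).1 hsum
    rw [hsum'.tsum_eq_zero_add, hzero, zero_add, besselClifford, ← tsum_neg]
    simp only [hsucc]
  · rw [← summable_nat_add_iff 1]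
    simpa using Real.summable_pow_div_factorial R
  · intro n y _
    exact ((hasDerivAt_pow n y).const_mul _).div_const _
  · intro n y hy
    rcases n with _ | n
    · simp [hzero]
    · have hy' : |y| ≤ R := by simpa using (mem_ball_zero_iff.1 hy).le
      rw [hsucc, norm_neg]
      refine (norm_besselClifford_term_le (k + 1) n y).trans ?_
      simp only [Nat.add_sub_cancel, Nat.add_eq_zero_iff, one_ne_zero, and_false, if_false]
      gcongr

lemma besselClifford_ode (s : ℝ) :
    s * besselClifford 2 s = besselClifford 1 s - besselClifford 0 s := by
  have h1 := summable_besselClifford 1 s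
  have h0 := summable_besselClifford 0 s
  rw [besselClifford, besselClifford, besselClifford, ← h1.tsum_sub h0,
    (h1.sub h0).tsum_eq_zero_add, ← tsum_mul_left]
  simp only [Nat.factorial_zero, pow_zero, zero_add, Nat.factorial_one, add_zero, sub_self]
  refine tsum_congr fun n => ?_
  rw [show n + 2 = n + 1 + 1 from rfl, Nat.factorial_succ (n + 1), Nat.factorial_succ n]
  push_cast
  field_simp
  ring

lemma besselJ_zero_eq (t : ℝ) : besselJ 0 t = besselClifford 0 (t ^ 2 / 4) := by
  refine tsum_congr fun n => ?_
  have h : (t / 2) ^ (2 * (n : ℝ) + 0) = (t ^ 2 / 4) ^ n := by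
    rw [add_zero, show (2 * (n : ℝ)) = ((2 * n : ℕ) : ℝ) by push_cast; ring, Real.rpow_natCast,
      pow_mul]
    congr 1; ring
  rw [h, add_zero, Real.Gamma_nat_eq_factorial, add_zero]

/-- The derivative of `J₀`. -/
noncomputable def besselJZeroDeriv (t : ℝ) : ℝ := -(t / 2) * besselClifford 1 (t ^ 2 / 4)

lemma hasDerivAt_besselJ_zero (t : ℝ) : HasDerivAt (besselJ 0) (besselJZeroDeriv t) t := by
  have h1 : HasDerivAt (fun t : ℝ => t ^ 2 / 4) (t / 2) t := by
    have := (hasDerivAt_pow 2 t).div_const 4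
    exact this.congr_deriv (by norm_num; ring)
  have h2 := (hasDerivAt_besselClifford 0 (t ^ 2 / 4)).comp t h1
  have h3 : besselJ 0 = besselClifford 0 ∘ fun t : ℝ => t ^ 2 / 4 := funext besselJ_zero_eq
  rw [h3]
  refine h2.congr_deriv ?_
  rw [besselJZeroDeriv]; ring

lemma hasDerivAt_besselJZeroDeriv {t : ℝ} (ht : t ≠ 0) :
    HasDerivAt besselJZeroDeriv (-besselJZeroDeriv t / t - besselJ 0 t) t := by
  have h1 : HasDerivAt (fun t : ℝ => t ^ 2 / 4) (t / 2) t := by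
    have := (hasDerivAt_pow 2 t).div_const 4
    exact this.congr_deriv (by norm_num; ring)
  have h2 := (hasDerivAt_besselClifford 1 (t ^ 2 / 4)).comp t h1
  have h3 := ((hasDerivAt_id t).div_const 2).neg.mul h2
  have h4 := besselClifford_ode (t ^ 2 / 4)
  refine h3.congr_deriv ?_
  rw [besselJZeroDeriv, besselJ_zero_eq]
  simp only [Function.comp, Pi.neg_apply, id]
  field_simp
  norm_num
  linear_combination 4 * h4

/-- The energy of `√t J₀(t)`, which is nonincreasing for `t > 0`. -/
noncomputable def besselJZeroEnergy (t : ℝ) : ℝ :=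
  t * besselJZeroDeriv t ^ 2 + besselJ 0 t * besselJZeroDeriv t + t * besselJ 0 t ^ 2 +
    besselJ 0 t ^ 2 / (2 * t)

lemma hasDerivAt_besselJZeroEnergy {t : ℝ} (ht : t ≠ 0) :
    HasDerivAt besselJZeroEnergy (-(besselJ 0 t ^ 2 / (2 * t ^ 2))) t := by
  have hy := hasDerivAt_besselJ_zero t
  have hw := hasDerivAt_besselJZeroDeriv ht
  have h := ((((hasDerivAt_id t).mul (hw.pow 2)).add (hy.mul hw)).add
    ((hasDerivAt_id t).mul (hy.pow 2))).add
    ((hy.pow 2).div ((hasDerivAt_id t).const_mul 2) (by simpa using ht))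
  refine h.congr_deriv ?_
  simp only [id, Pi.pow_apply]
  field_simp
  ring

lemma mul_besselJ_zero_sq_le {t : ℝ} (ht : 1 ≤ t) :
    t * besselJ 0 t ^ 2 ≤ besselJZeroEnergy 1 := by
  have hanti : AntitoneOn besselJZeroEnergy (Ici 1) := by
    refine antitoneOn_of_deriv_nonpos (convex_Ici 1) (fun s hs => ?_) (fun s hs => ?_)
      fun s hs => ?_
    · exact (hasDerivAt_besselJZeroEnergy (by
        have : (1 : ℝ) ≤ s := hs
        linarith)).continuousAt.continuousWithinAt
    all_goals
      rw [interior_Ici] at hs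
      have h1 : s ≠ 0 := (zero_lt_one.trans (mem_Ioi.1 hs)).ne'
    · exact (hasDerivAt_besselJZeroEnergy h1).differentiableAt.differentiableWithinAt
    · rw [(hasDerivAt_besselJZeroEnergy h1).deriv, neg_nonpos]
      positivity
  refine le_trans ?_ (hanti self_mem_Ici (mem_Ici.2 ht) ht)
  have ht0 : 0 < t := by linarith
  have : besselJZeroEnergy t = t * besselJ 0 t ^ 2 +
      t * ((besselJZeroDeriv t + besselJ 0 t / (2 * t)) ^ 2 +
        (besselJ 0 t / (2 * t)) ^ 2) := by
    rw [besselJZeroEnergy]; field_simp; ring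
  rw [this]
  have : 0 ≤ t * ((besselJZeroDeriv t + besselJ 0 t / (2 * t)) ^ 2 +
        (besselJ 0 t / (2 * t)) ^ 2) := by positivity
  linarith

lemma bddAbove_rpow_third_mul_besselJ_zero :
    BddAbove ((fun t : ℝ => t ^ ((1 : ℝ) / 3) * besselJ 0 t) '' Ici 0) := by
  have hcont : ContinuousOn (fun t : ℝ => t ^ ((1 : ℝ) / 3) * besselJ 0 t) (Icc 0 1) :=
    ((Real.continuous_rpow_const (by norm_num)).mul (continuous_iff_continuousAt.2 fun t =>
      (hasDerivAt_besselJ_zero t).continuousAt)).continuousOn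
  have h1 := (isCompact_Icc.image_of_continuousOn hcont).bddAbove
  rw [← Icc_union_Ici_eq_Ici (zero_le_one (α := ℝ)), image_union]
  refine h1.union ⟨(1 + besselJZeroEnergy 1) / 2, ?_⟩
  rintro _ ⟨t, ht, rfl⟩
  have ht1 : 1 ≤ t := ht
  have h2 := mul_besselJ_zero_sq_le ht1
  have h3 : (t ^ ((1 : ℝ) / 3)) ^ 2 ≤ t := by
    rw [← Real.rpow_natCast, ← Real.rpow_mul (by linarith)]
    calc _ ≤ t ^ (1 : ℝ) := Real.rpow_le_rpow_of_exponent_le ht1 (by norm_num)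
      _ = t := Real.rpow_one t
  have h4 := mul_le_mul_of_nonneg_right h3 (sq_nonneg (besselJ 0 t))
  simp only
  nlinarith [sq_nonneg (t ^ ((1 : ℝ) / 3) * besselJ 0 t - 1)]

lemma besselJ_zero_one_ge : (0.765 : ℝ) ≤ besselJ 0 1 := by
  rw [besselJ_zero_eq]
  have hf : Antitone fun n : ℕ => (1 / 4 : ℝ) ^ n / ((n.factorial : ℝ) * n.factorial) := by
    intro m n hmn
    have h1 : (m.factorial : ℝ) ≤ n.factorial := by exact_mod_cast Nat.factorial_le hmn
    have h2 : (1 / 4 : ℝ) ^ n ≤ (1 / 4) ^ m :=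
      pow_le_pow_of_le_one (by norm_num) (by norm_num) hmn
    simp only
    gcongr
  have h := (summable_besselClifford 0 (1 ^ 2 / 4)).hasSum.tendsto_sum_nat
  have h2 := hf.alternating_series_le_tendsto (l := besselClifford 0 (1 ^ 2 / 4)) (by
    refine h.congr fun n => Finset.sum_congr rfl fun i _ => ?_
    rw [add_zero, one_pow, mul_div_assoc]) 2
  refine le_trans ?_ h2
  norm_num [Finset.sum_range_succ, Nat.factorial]

lemma landau_cL_ge : (0.765 : ℝ) ≤ landau_cL := by
  refine besselJ_zero_one_ge.trans
    (le_csSup bddAbove_rpow_third_mul_besselJ_zero ⟨1, by simp, ?_⟩)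
  simp

theorem stmt1 (μ ν x : ℝ) (hμν : ν ≤ μ) (hν : 0 < ν) (hx : 0 < x) :
    besselK ν x * besselI μ x ≤
      2 * Real.pi ^ ((3 : ℝ) / 2) * landau_cL /
        (Real.sqrt 3 * Real.Gamma (2 / 3) * Real.Gamma (5 / 6) * (2 * x) ^ ((1 : ℝ) / 3)) := by
  refine (besselK_mul_besselI_le hμν hν hx).trans ?_
  have hG1 : 0 < Real.Gamma (2 / 3) := Real.Gamma_pos_of_pos (by norm_num)
  have hG2 : 0 < Real.Gamma (5 / 6) := Real.Gamma_pos_of_pos (by norm_num)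
  have hpi := Real.pi_gt_d2
  have hx2 : (x / 2) ^ (-(1 / 3) : ℝ) * (2 * x) ^ ((1 : ℝ) / 3) = 4 ^ ((1 : ℝ) / 3) := by
    rw [show 2 * x = x / 2 * 4 by ring, Real.mul_rpow (by positivity) (by norm_num), ← mul_assoc,
      ← Real.rpow_add (by positivity)]
    simp
  have h4 : (4 : ℝ) ^ ((1 : ℝ) / 3) ≤ 1.5875 := by
    calc (4 : ℝ) ^ ((1 : ℝ) / 3) ≤ ((1.5875 : ℝ) ^ 3) ^ ((1 : ℝ) / 3) :=
          Real.rpow_le_rpow (by norm_num) (by norm_num) (by norm_num)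
      _ = 1.5875 := by rw [← Real.rpow_natCast, ← Real.rpow_mul (by norm_num)]; norm_num
  have h3 : √3 ≤ 1.7321 := Real.sqrt_le_iff.2 ⟨by norm_num, by norm_num⟩
  have hpi32 : Real.pi ^ ((3 : ℝ) / 2) = Real.pi * √Real.pi := by
    rw [Real.sqrt_eq_rpow, show (3 / 2 : ℝ) = 1 + 1 / 2 by norm_num, Real.rpow_add Real.pi_pos,
      Real.rpow_one]
  rw [le_div_iff₀ (by positivity), hpi32]
  calc 6 / Real.pi * (x / 2) ^ (-(1 / 3) : ℝ) *
        (√3 * Real.Gamma (2 / 3) * Real.Gamma (5 / 6) * (2 * x) ^ ((1 : ℝ) / 3))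
      = 6 / Real.pi * 4 ^ ((1 : ℝ) / 3) * √3 *
        (Real.Gamma (2 / 3) * Real.Gamma (5 / 6)) := by rw [← hx2]; ring
    _ ≤ 6 / Real.pi * 1.5875 * 1.7321 * (9 / 10 * √Real.pi) := by
        refine mul_le_mul ?_ Gamma_two_thirds_mul_Gamma_five_sixths_le (by positivity)
          (by positivity)
        gcongr
    _ = 6 * 1.5875 * 1.7321 * (9 / 10) * (√Real.pi / Real.pi) := by ring
    _ ≤ 2 * Real.pi ^ 2 * 0.765 * (√Real.pi / Real.pi) := by
        refine mul_le_mul_of_nonneg_right ?_ (by positivity)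
        nlinarith
    _ = 2 * (Real.pi * √Real.pi) * 0.765 := by field_simp
    _ ≤ 2 * (Real.pi * √Real.pi) * landau_cL := by
        gcongr
        exact landau_cL_ge
end

section
/- For all x ∈ (0, 1], the strict inequality ln 2 - γ < I_0(x) K_0(x) + ln x ≤ I_0(1) K_0(1) holds, where γ is the Euler–Mascheroni constant; moreover the constants ln 2 - γ and I_0(1)K_0(1) ≈ 0.533045 are best possible. -/
open Real MeasureTheory Set Filter

lemma self_le_cosh {t : ℝ} (ht : 0 ≤ t) : t ≤ Real.cosh t :=
  (Real.self_le_sinh_iff.2 ht).trans (Real.sinh_lt_cosh t).le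

/-- The integral `∫₀^∞ e^{-x cosh t} (cosh t)^k dt`; it is `K₀ x` for `k = 0`
and `K₁ x` for `k = 1`. -/
noncomputable def coshMoment (k : ℕ) (x : ℝ) : ℝ :=
  ∫ t in Ioi (0 : ℝ), Real.exp (-x * Real.cosh t) * Real.cosh t ^ k

lemma integrableOn_coshMoment (k : ℕ) {x : ℝ} (hx : 0 < x) :
    IntegrableOn (fun t => Real.exp (-x * Real.cosh t) * Real.cosh t ^ k) (Ioi (0 : ℝ)) := by
  have hI := (exp_neg_integrableOn_Ioi 0 (half_pos hx)).const_mul ((k.factorial : ℝ) / (x / 2) ^ k)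
  refine hI.mono' (by fun_prop) ?_
  refine (ae_restrict_iff' measurableSet_Ioi).2 (.of_forall fun t ht => ?_)
  have hc := Real.cosh_pos t
  have h1 := Real.pow_div_factorial_le_exp (x := x / 2 * Real.cosh t) (by positivity) k
  have h2 : Real.cosh t ^ k ≤ (k.factorial : ℝ) / (x / 2) ^ k * Real.exp (x / 2 * Real.cosh t) := by
    rw [mul_pow, div_le_iff₀ (by positivity)] at h1
    rw [div_mul_eq_mul_div, le_div_iff₀ (by positivity)]
    linarith
  have h3 : Real.exp (-(x / 2) * Real.cosh t) ≤ Real.exp (-(x / 2) * t) :=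
    Real.exp_le_exp.2 (by nlinarith [self_le_cosh ht.le])
  rw [Real.norm_of_nonneg (by positivity)]
  calc Real.exp (-x * Real.cosh t) * Real.cosh t ^ k
      ≤ Real.exp (-x * Real.cosh t) *
        ((k.factorial : ℝ) / (x / 2) ^ k * Real.exp (x / 2 * Real.cosh t)) := by gcongr
    _ = (k.factorial : ℝ) / (x / 2) ^ k * Real.exp (-(x / 2) * Real.cosh t) := by
        rw [mul_left_comm, ← Real.exp_add]; ring_nf
    _ ≤ _ := by gcongr

lemma coshMoment_pos (k : ℕ) {x : ℝ} (hx : 0 < x) : 0 < coshMoment k x := by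
  refine (setIntegral_pos_iff_support_of_nonneg_ae (.of_forall fun t => ?_)
    (integrableOn_coshMoment k hx)).2 ?_
  · have := Real.cosh_pos t
    simp only [Pi.zero_apply]
    positivity
  · have : Function.support (fun t => Real.exp (-x * Real.cosh t) * Real.cosh t ^ k) = univ := by
      ext t
      simp [(Real.cosh_pos t).ne']
    rw [this, univ_inter]
    simp

lemma hasDerivAt_coshMoment (k : ℕ) {x : ℝ} (hx : 0 < x) :
    HasDerivAt (coshMoment k) (-coshMoment (k + 1) x) x := by
  have h := (hasDerivAt_integral_of_dominated_loc_of_deriv_le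
    (F := fun y t => Real.exp (-y * Real.cosh t) * Real.cosh t ^ k)
    (F' := fun y t => -(Real.exp (-y * Real.cosh t) * Real.cosh t ^ (k + 1)))
    (bound := fun t => Real.exp (-(x / 2) * Real.cosh t) * Real.cosh t ^ (k + 1))
    (μ := volume.restrict (Ioi (0 : ℝ))) (x₀ := x) (Ioi_mem_nhds (half_lt_self hx))
    (.of_forall fun y => by fun_prop) (integrableOn_coshMoment k hx) (by fun_prop)
    (.of_forall fun t y hy => ?_) (integrableOn_coshMoment (k + 1) (half_pos hx))
    (.of_forall fun t y _ => ?_)).2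
  · rw [integral_neg] at h
    exact h
  · have := Real.cosh_pos t
    rw [norm_neg, Real.norm_of_nonneg (by positivity)]
    gcongr
    exact (mem_Ioi.1 hy).le
  · have := ((hasDerivAt_neg y).mul_const (Real.cosh t)).exp.mul_const (Real.cosh t ^ k)
    exact this.congr_deriv (by ring)

lemma tendsto_exp_neg_mul_cosh_mul_cosh {x : ℝ} (hx : 0 < x) :
    Tendsto (fun t => Real.exp (-x * Real.cosh t) * Real.cosh t) atTop (nhds 0) := by
  have h1 : Tendsto Real.cosh atTop atTop :=
    tendsto_atTop_mono' _ (eventually_ge_atTop 0 |>.mono fun t ht => self_le_cosh ht) tendsto_id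
  have h2 := (Real.tendsto_pow_mul_exp_neg_atTop_nhds_zero 1).comp (h1.const_mul_atTop hx)
  have h3 := h2.const_mul x⁻¹
  rw [mul_zero] at h3
  refine h3.congr fun t => ?_
  simp only [Function.comp_apply, pow_one]
  field_simp

/-- The modified Bessel equation satisfied by `K₀`. -/
lemma coshMoment_ode {x : ℝ} (hx : 0 < x) :
    x * coshMoment 2 x = coshMoment 1 x + x * coshMoment 0 x := by
  have hi (k : ℕ) := integrableOn_coshMoment k hx
  have hs : IntegrableOn (fun t => Real.exp (-x * Real.cosh t) * Real.cosh t ^ 1 -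
      x * (Real.exp (-x * Real.cosh t) * Real.cosh t ^ 2)) (Ioi (0 : ℝ)) :=
    (hi 1).sub ((hi 2).const_mul x)
  have h := integral_Ioi_of_hasDerivAt_of_tendsto' (a := (0 : ℝ)) (m := 0)
    (f := fun t => Real.exp (-x * Real.cosh t) * Real.sinh t)
    (f' := fun t => Real.exp (-x * Real.cosh t) * Real.cosh t ^ 1 -
      x * (Real.exp (-x * Real.cosh t) * Real.cosh t ^ 2) +
      x * (Real.exp (-x * Real.cosh t) * Real.cosh t ^ 0)) (fun t _ => ?_)
    (hs.add ((hi 0).const_mul x)) ?_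
  · rw [integral_add hs ((hi 0).const_mul x),
      integral_sub (hi 1) ((hi 2).const_mul x), integral_const_mul, integral_const_mul] at h
    simp only [Real.sinh_zero, mul_zero, sub_zero] at h
    unfold coshMoment
    linarith
  · have := (((Real.hasDerivAt_cosh t).const_mul (-x)).exp).mul (Real.hasDerivAt_sinh t)
    refine this.congr_deriv ?_
    rw [Real.cosh_sq]
    ring
  · refine squeeze_zero' ?_ ?_ (tendsto_exp_neg_mul_cosh_mul_cosh hx)
    · filter_upwards [eventually_ge_atTop 0] with t ht
      have := Real.sinh_nonneg_iff.2 ht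
      positivity
    · exact .of_forall fun t => by
        have := (Real.sinh_lt_cosh t).le
        gcongr

lemma integral_exp_neg_mul_cosh_mul_sinh {x : ℝ} (hx : 0 < x) :
    IntegrableOn (fun t => x * (Real.exp (-x * Real.cosh t) * Real.sinh t)) (Ioi (0 : ℝ)) ∧
    ∫ t in Ioi (0 : ℝ), x * (Real.exp (-x * Real.cosh t) * Real.sinh t) = Real.exp (-x) := by
  have hint : IntegrableOn (fun t => x * (Real.exp (-x * Real.cosh t) * Real.sinh t))
      (Ioi (0 : ℝ)) := by
    refine Integrable.const_mul ((integrableOn_coshMoment 1 hx).mono' (by fun_prop) ?_) x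
    refine (ae_restrict_iff' measurableSet_Ioi).2 (.of_forall fun t ht => ?_)
    have := Real.sinh_nonneg_iff.2 (mem_Ioi.1 ht).le
    have := (Real.sinh_lt_cosh t).le
    rw [Real.norm_of_nonneg (by positivity), pow_one]
    gcongr
  refine ⟨hint, ?_⟩
  have h := integral_Ioi_of_hasDerivAt_of_tendsto' (a := (0 : ℝ)) (m := 0)
    (f := fun t => -Real.exp (-x * Real.cosh t)) (fun t _ => ?_) hint ?_
  · simpa using h
  · exact (((Real.hasDerivAt_cosh t).const_mul (-x)).exp.neg).congr_deriv (by ring)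
  · rw [← neg_zero]
    refine (squeeze_zero (fun t => (Real.exp_pos _).le) (fun t => ?_)
      (tendsto_exp_neg_mul_cosh_mul_cosh hx)).neg
    exact le_mul_of_one_le_right (Real.exp_pos _).le (Real.one_le_cosh t)

lemma integral_exp_neg_Ioi_zero' :
    IntegrableOn (fun t : ℝ => Real.exp (-t)) (Ioi 0) ∧ ∫ t in Ioi (0 : ℝ), Real.exp (-t) = 1 :=
  ⟨by simpa using exp_neg_integrableOn_Ioi 0 one_pos, integral_exp_neg_Ioi_zero⟩

lemma mul_coshMoment_one_bounds {x : ℝ} (hx : 0 < x) :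
    Real.exp (-x) ≤ x * coshMoment 1 x ∧ x * coshMoment 1 x ≤ Real.exp (-x) + x := by
  obtain ⟨hi, hv⟩ := integral_exp_neg_mul_cosh_mul_sinh hx
  obtain ⟨ei, ev⟩ := integral_exp_neg_Ioi_zero'
  have hi1 := (integrableOn_coshMoment 1 hx).const_mul x
  unfold coshMoment
  rw [← integral_const_mul, ← hv]
  constructor
  · refine integral_mono hi hi1 fun t => ?_
    have := (Real.sinh_lt_cosh t).le
    simp only [pow_one]
    gcongr
  · calc _ ≤ ∫ t in Ioi (0 : ℝ), (x * (Real.exp (-x * Real.cosh t) * Real.sinh t) +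
          x * Real.exp (-t)) := by
          refine integral_mono hi1 (hi.add (ei.const_mul x)) fun t => ?_
          have h1 := Real.cosh_sub_sinh t
          have h2 : Real.exp (-x * Real.cosh t) ≤ 1 :=
            Real.exp_le_one_iff.2 (by nlinarith [Real.cosh_pos t])
          have h3 := mul_le_of_le_one_left (Real.exp_pos (-t)).le h2
          simp only [pow_one]
          rw [← mul_add]
          gcongr
          rw [← h1] at h3 ⊢
          linarith
      _ = _ := by rw [integral_add hi (ei.const_mul x),
            integral_const_mul x fun t => Real.exp (-t), ev, mul_one]

lemma tendsto_mul_coshMoment_one :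
    Tendsto (fun x => x * coshMoment 1 x) (nhdsWithin 0 (Ioi 0)) (nhds 1) := by
  have hc : Continuous fun x : ℝ => Real.exp (-x) := by fun_prop
  have h1 : Tendsto (fun x : ℝ => Real.exp (-x)) (nhdsWithin 0 (Ioi 0)) (nhds 1) :=
    (hc.tendsto' 0 1 (by simp)).mono_left nhdsWithin_le_nhds
  have h2 : Tendsto (fun x : ℝ => Real.exp (-x) + x) (nhdsWithin 0 (Ioi 0)) (nhds 1) :=
    ((hc.add continuous_id).tendsto' 0 1 (by simp)).mono_left nhdsWithin_le_nhds
  refine tendsto_of_tendsto_of_tendsto_of_le_of_le' h1 h2 ?_ ?_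
  · filter_upwards [self_mem_nhdsWithin] with x hx using (mul_coshMoment_one_bounds hx).1
  · filter_upwards [self_mem_nhdsWithin] with x hx using (mul_coshMoment_one_bounds hx).2

lemma coshMoment_zero_le_one {x : ℝ} (hx : 0 < x) : coshMoment 0 x ≤ coshMoment 1 x := by
  refine integral_mono (integrableOn_coshMoment 0 hx) (integrableOn_coshMoment 1 hx) fun t => ?_
  have := Real.one_le_cosh t
  simp only [pow_zero, pow_one]
  gcongr

lemma integral_log_mul_exp_neg :
    IntegrableOn (fun t : ℝ => Real.log t * Real.exp (-t)) (Ioi 0) ∧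
    ∫ t in Ioi (0 : ℝ), Real.log t * Real.exp (-t) = -Real.eulerMascheroniConstant := by
  have h1 := Complex.hasDerivAt_GammaIntegral (s := 1) (by simp)
  have h2 : Complex.GammaIntegral =ᶠ[nhds 1] Complex.Gamma := by
    have : {s : ℂ | 0 < s.re} ∈ nhds (1 : ℂ) :=
      (isOpen_lt continuous_const Complex.continuous_re).mem_nhds (by simp)
    filter_upwards [this] with s hs using (Complex.Gamma_eq_integral hs).symm
  have h3 := (h1.congr_of_eventuallyEq h2.symm).unique Complex.hasDerivAt_Gamma_one
  have h4 : ∫ t in Ioi (0 : ℝ), Real.log t * Real.exp (-t) = -Real.eulerMascheroniConstant := by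
    rw [← Complex.ofReal_inj, ← integral_complex_ofReal]
    simpa using h3
  refine ⟨?_, h4⟩
  by_contra h
  have := integral_undef h
  rw [h4] at this
  linarith [Real.one_half_lt_eulerMascheroniConstant]

lemma integral_exp_neg_div {a : ℝ} (ha : 0 < a) :
    IntegrableOn (fun u : ℝ => Real.exp (-u) / u) (Ioi a) ∧
    ∫ u in Ioi a, Real.exp (-u) / u =
      (∫ u in Ioi a, Real.log u * Real.exp (-u)) - Real.exp (-a) * Real.log a := by
  have hl := integral_log_mul_exp_neg.1.mono_set (Ioi_subset_Ioi ha.le)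
  have he : IntegrableOn (fun u : ℝ => Real.exp (-u)) (Ioi a) := by
    simpa using exp_neg_integrableOn_Ioi a one_pos
  have hd : IntegrableOn (fun u : ℝ => Real.exp (-u) / u) (Ioi a) := by
    refine (he.div_const a).mono' (Measurable.aestronglyMeasurable (by fun_prop)) ?_
    refine (ae_restrict_iff' measurableSet_Ioi).2 (.of_forall fun t ht => ?_)
    have ht' : 0 < t := ha.trans ht
    rw [Real.norm_of_nonneg (by positivity)]
    have := (mem_Ioi.1 ht).le
    gcongr
  refine ⟨hd, ?_⟩
  have h := integral_Ioi_of_hasDerivAt_of_tendsto' (a := a) (m := 0)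
    (f := fun u => Real.exp (-u) * Real.log u)
    (f' := fun u => Real.exp (-u) / u - Real.log u * Real.exp (-u)) (fun t ht => ?_)
    (hd.sub hl) ?_
  · rw [integral_sub hd hl] at h
    linarith
  · have ht' : t ≠ 0 := (ha.trans_le ht).ne'
    exact ((hasDerivAt_neg t).exp.mul (Real.hasDerivAt_log ht')).congr_deriv (by field_simp; ring)
  · have h1 := Real.tendsto_pow_mul_exp_neg_atTop_nhds_zero 1
    refine squeeze_zero' ?_ ?_ h1
    · filter_upwards [eventually_ge_atTop 1] with t ht
      have := Real.log_nonneg ht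
      positivity
    · filter_upwards [eventually_gt_atTop 0] with t ht
      rw [mul_comm, pow_one]
      gcongr
      exact Real.log_le_self ht.le

lemma integral_exp_neg_mul_exp {a : ℝ} (ha : 0 < a) :
    IntegrableOn (fun t : ℝ => Real.exp (-(a * Real.exp t))) (Ioi 0) ∧
    ∫ t in Ioi (0 : ℝ), Real.exp (-(a * Real.exp t)) = ∫ u in Ioi a, Real.exp (-u) / u := by
  have hi : IntegrableOn (fun t : ℝ => Real.exp (-(a * Real.exp t))) (Ioi 0) := by
    refine (exp_neg_integrableOn_Ioi 0 ha).mono' (by fun_prop) ?_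
    refine .of_forall fun t => ?_
    rw [Real.norm_of_nonneg (by positivity)]
    exact Real.exp_le_exp.2 (by nlinarith [Real.add_one_le_exp t])
  refine ⟨hi, ?_⟩
  have himg : ∀ u ∈ (fun t => a * Real.exp t) '' Ici 0, a ≤ u := by
    rintro _ ⟨t, ht, rfl⟩
    exact le_mul_of_one_le_right ha.le (Real.one_le_exp ht)
  have hfun : (fun t : ℝ => ((fun u => Real.exp (-u) / u) ∘ fun t => a * Real.exp t) t *
      (a * Real.exp t)) = fun t => Real.exp (-(a * Real.exp t)) := by
    ext t
    simp only [Function.comp_apply]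
    field_simp
  have h := integral_comp_mul_deriv_Ioi (a := 0) (f := fun t => a * Real.exp t)
    (f' := fun t => a * Real.exp t) (g := fun u => Real.exp (-u) / u) (by fun_prop)
    (Real.tendsto_exp_atTop.const_mul_atTop ha)
    (fun t _ => ((Real.hasDerivAt_exp t).const_mul a).hasDerivWithinAt) ?_ ?_ ?_
  · rw [hfun] at h
    simpa using h
  · refine ContinuousOn.div (by fun_prop) (by fun_prop) fun u hu => ?_
    exact (ha.trans_le (himg u (image_mono Ioi_subset_Ici_self hu))).ne'
  · exact ((integrableOn_Ici_iff_integrableOn_Ioi (by simp)).2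
      (integral_exp_neg_div ha).1).mono_set himg
  · rw [hfun]
    exact (integrableOn_Ici_iff_integrableOn_Ioi (by simp)).2 hi

lemma tendsto_integral_exp_neg_mul_exp_add_log :
    Tendsto (fun a => (∫ t in Ioi (0 : ℝ), Real.exp (-(a * Real.exp t))) + Real.log a)
      (nhdsWithin 0 (Ioi 0)) (nhds (-Real.eulerMascheroniConstant)) := by
  have h1 : Tendsto (fun a => ∫ u in Ioi a, Real.log u * Real.exp (-u))
      (nhdsWithin 0 (Ioi 0)) (nhds (-Real.eulerMascheroniConstant)) := by
    have hc : AECover (volume.restrict (Ioi (0 : ℝ))) (nhdsWithin 0 (Ioi 0)) fun a : ℝ => Ioi a :=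
      aecover_Ioi_of_Ioi (tendsto_id.mono_left nhdsWithin_le_nhds)
    have := hc.integral_tendsto_of_countably_generated integral_log_mul_exp_neg.1
    rw [integral_log_mul_exp_neg.2] at this
    refine this.congr' ?_
    filter_upwards [self_mem_nhdsWithin] with a ha
    rw [Measure.restrict_restrict measurableSet_Ioi,
      inter_eq_self_of_subset_left (Ioi_subset_Ioi (mem_Ioi.1 ha).le)]
  have h2 : Tendsto (fun a => (1 - Real.exp (-a)) * Real.log a)
      (nhdsWithin 0 (Ioi 0)) (nhds 0) := by
    have h3 : Tendsto (fun a : ℝ => ‖a * Real.log a‖) (nhdsWithin 0 (Ioi 0)) (nhds 0) :=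
      (Real.continuous_mul_log.norm.tendsto' 0 0 (by simp)).mono_left nhdsWithin_le_nhds
    refine squeeze_zero_norm' ?_ h3
    filter_upwards [self_mem_nhdsWithin] with a ha
    have ha' : 0 < a := ha
    rw [norm_mul, norm_mul]
    gcongr
    rw [Real.norm_of_nonneg, Real.norm_of_nonneg ha'.le]
    · linarith [Real.add_one_le_exp (-a)]
    · linarith [Real.exp_le_one_iff.2 (neg_nonpos.2 ha'.le)]
  have h4 := h1.add h2
  rw [add_zero] at h4
  refine h4.congr' ?_
  filter_upwards [self_mem_nhdsWithin] with a ha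
  rw [(integral_exp_neg_mul_exp ha).2, (integral_exp_neg_div ha).2]
  ring

lemma hasDerivAt_tsum_mul_pow {c : ℕ → ℝ} (hc : ∀ n, |c n| ≤ 1 / (n.factorial : ℝ)) (y : ℝ) :
    HasDerivAt (fun y => ∑' n : ℕ, c n / (n + 1) * y ^ (n + 1)) (∑' n : ℕ, c n * y ^ n) y := by
  have hy : y ∈ Metric.ball (0 : ℝ) (|y| + 1) := by simp
  refine hasDerivAt_tsum_of_isPreconnected (g := fun n y => c n / (n + 1) * y ^ (n + 1))
    (g' := fun n y => c n * y ^ n) (Real.summable_pow_div_factorial (|y| + 1))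
    Metric.isOpen_ball (convex_ball 0 _).isPreconnected (fun n z _ => ?_) (fun n z hz => ?_)
    (Metric.mem_ball_self (by positivity)) (by simp [summable_zero]) hy
  · have := (hasDerivAt_pow (n + 1) z).const_mul (c n / (n + 1))
    refine this.congr_deriv ?_
    push_cast
    have : (n : ℝ) + 1 ≠ 0 := by positivity
    field_simp
  · have hz' : |z| ≤ |y| + 1 := by simpa using (Metric.mem_ball.1 hz).le
    rw [norm_mul, norm_pow, Real.norm_eq_abs, Real.norm_eq_abs, ← one_div_mul_eq_div]
    gcongr
    exact hc n

/-- The entire function `∑ yⁿ / (n! (n + k)!)`. -/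
noncomputable def besselSeries (k : ℕ) (y : ℝ) : ℝ :=
  ∑' n : ℕ, 1 / ((n.factorial : ℝ) * (n + k).factorial) * y ^ n

lemma abs_one_div_factorial_mul_le (k n : ℕ) :
    |1 / ((n.factorial : ℝ) * (n + k).factorial)| ≤ 1 / (n.factorial : ℝ) := by
  rw [abs_of_nonneg (by positivity)]
  have : (1 : ℝ) ≤ (n + k).factorial := by
    exact_mod_cast Nat.one_le_iff_ne_zero.2 (Nat.factorial_ne_zero _)
  gcongr
  exact le_mul_of_one_le_right (by positivity) this

lemma summable_besselSeries (k : ℕ) (y : ℝ) :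
    Summable fun n : ℕ => 1 / ((n.factorial : ℝ) * (n + k).factorial) * y ^ n := by
  refine .of_norm_bounded (Real.summable_pow_div_factorial |y|) fun n => ?_
  rw [norm_mul, norm_pow, Real.norm_eq_abs, Real.norm_eq_abs,
    ← one_div_mul_eq_div (n.factorial : ℝ)]
  exact mul_le_mul_of_nonneg_right (abs_one_div_factorial_mul_le k n) (by positivity)

lemma hasDerivAt_besselSeries_zero (y : ℝ) :
    HasDerivAt (besselSeries 0) (besselSeries 1 y) y := by
  have h := (hasDerivAt_tsum_mul_pow (abs_one_div_factorial_mul_le 1) y).const_add 1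
  have heq : besselSeries 0 = fun y => 1 + ∑' n : ℕ,
      1 / ((n.factorial : ℝ) * (n + 1).factorial) / (n + 1) * y ^ (n + 1) := by
    ext z
    rw [besselSeries, (summable_besselSeries 0 z).tsum_eq_zero_add]
    simp only [add_zero, Nat.factorial_zero, Nat.cast_one, mul_one, div_one, pow_zero]
    congr 1
    refine tsum_congr fun n => ?_
    congr 1
    rw [div_div]
    congr 1
    rw [Nat.factorial_succ]
    push_cast
    ring
  rw [heq]
  exact h

lemma hasDerivAt_mul_besselSeries_one (y : ℝ) :
    HasDerivAt (fun y => y * besselSeries 1 y) (besselSeries 0 y) y := by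
  have h := hasDerivAt_tsum_mul_pow (abs_one_div_factorial_mul_le 0) y
  have heq : (fun y => y * besselSeries 1 y) = fun y => ∑' n : ℕ,
      1 / ((n.factorial : ℝ) * (n + 0).factorial) / (n + 1) * y ^ (n + 1) := by
    ext z
    rw [besselSeries, ← tsum_mul_left]
    refine tsum_congr fun n => ?_
    rw [add_zero, div_div, Nat.factorial_succ, pow_succ]
    push_cast
    ring
  rw [heq]
  exact h

lemma besselI_zero_eq (x : ℝ) : besselI 0 x = besselSeries 0 (x ^ 2 / 4) := by
  refine tsum_congr fun n => ?_
  rw [add_zero, add_zero, add_zero, Real.Gamma_nat_eq_factorial,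
    show (2 * (n : ℝ)) = ((2 * n : ℕ) : ℝ) by push_cast; ring, Real.rpow_natCast, pow_mul,
    one_div, div_eq_inv_mul]
  congr 2
  ring

lemma besselSeries_pos (k : ℕ) {y : ℝ} (hy : 0 ≤ y) : 0 < besselSeries k y := by
  refine (summable_besselSeries k y).tsum_pos (fun n => by positivity) 0 ?_
  simp only [pow_zero, mul_one]
  positivity

lemma besselK_zero_eq (x : ℝ) : besselK 0 x = coshMoment 0 x := by
  simp [besselK, coshMoment]

lemma tendsto_coshMoment_zero_add_log :
    Tendsto (fun x => coshMoment 0 x + Real.log x) (nhdsWithin 0 (Ioi 0))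
      (nhds (Real.log 2 - Real.eulerMascheroniConstant)) := by
  have hhalf : Tendsto (fun x : ℝ => x / 2) (nhdsWithin 0 (Ioi 0)) (nhdsWithin 0 (Ioi 0)) := by
    refine tendsto_nhdsWithin_iff.2 ⟨?_, ?_⟩
    · exact ((continuous_id.div_const 2).tendsto' 0 0 (by simp)).mono_left nhdsWithin_le_nhds
    · filter_upwards [self_mem_nhdsWithin] with x hx using half_pos (mem_Ioi.1 hx)
  have h1 := tendsto_integral_exp_neg_mul_exp_add_log.comp hhalf
  have h2 : Tendsto (fun x =>
      coshMoment 0 x - ∫ t in Ioi (0 : ℝ), Real.exp (-(x / 2 * Real.exp t)))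
      (nhdsWithin 0 (Ioi 0)) (nhds 0) := by
    refine squeeze_zero_norm' ?_ (hhalf.mono_right nhdsWithin_le_nhds)
    filter_upwards [self_mem_nhdsWithin] with x hx
    have hx : 0 < x := hx
    obtain ⟨ei, ev⟩ := integral_exp_neg_Ioi_zero'
    have hi := (integral_exp_neg_mul_exp (half_pos hx)).1
    rw [coshMoment, ← integral_sub (integrableOn_coshMoment 0 hx) hi]
    calc _ ≤ ∫ t in Ioi (0 : ℝ), x / 2 * Real.exp (-t) := by
          refine norm_integral_le_of_norm_le (ei.const_mul _) (.of_forall fun t => ?_)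
          have hE := Real.exp_pos t
          have hE' := Real.exp_pos (-t)
          have hsplit : Real.exp (-x * Real.cosh t) =
              Real.exp (-(x / 2 * Real.exp t)) * Real.exp (-(x / 2 * Real.exp (-t))) := by
            rw [← Real.exp_add, Real.cosh_eq]
            ring_nf
          have hA : Real.exp (-(x / 2 * Real.exp t)) ≤ 1 :=
            Real.exp_le_one_iff.2 (neg_nonpos.2 (by positivity))
          have hB : Real.exp (-(x / 2 * Real.exp (-t))) ≤ 1 :=
            Real.exp_le_one_iff.2 (neg_nonpos.2 (by positivity))
          have hC := Real.add_one_le_exp (-(x / 2 * Real.exp (-t)))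
          rw [pow_zero, mul_one, hsplit, norm_sub_rev, ← mul_one_sub, norm_mul,
            Real.norm_of_nonneg (by positivity), Real.norm_of_nonneg (by linarith)]
          calc _ ≤ 1 * (1 - Real.exp (-(x / 2 * Real.exp (-t)))) := by
                gcongr
            _ ≤ _ := by linarith
      _ = x / 2 := by rw [integral_const_mul, ev, mul_one]
  have h3 := (h1.add h2).add_const (Real.log 2)
  rw [add_zero, neg_add_eq_sub] at h3
  refine h3.congr' ?_
  filter_upwards [self_mem_nhdsWithin] with x hx
  simp only [Function.comp_apply]
  rw [Real.log_div (mem_Ioi.1 hx).ne' two_ne_zero]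
  ring

/-- `I₁`, written through its power series. -/
noncomputable def besselIOne (x : ℝ) : ℝ := x / 2 * besselSeries 1 (x ^ 2 / 4)

lemma hasDerivAt_besselI_zero (x : ℝ) : HasDerivAt (besselI 0) (besselIOne x) x := by
  rw [funext besselI_zero_eq]
  have h := (hasDerivAt_besselSeries_zero (x ^ 2 / 4)).comp x ((hasDerivAt_pow 2 x).div_const 4)
  exact h.congr_deriv (by simp only [besselIOne]; push_cast; ring)

lemma hasDerivAt_mul_besselIOne (x : ℝ) :
    HasDerivAt (fun x => x * besselIOne x) (x * besselI 0 x) x := by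
  have h := ((hasDerivAt_mul_besselSeries_one (x ^ 2 / 4)).comp x
    ((hasDerivAt_pow 2 x).div_const 4)).const_mul 2
  have heq : (fun x => x * besselIOne x) =
      fun x => 2 * ((fun y => y * besselSeries 1 y) ∘ fun x => x ^ 2 / 4) x := by
    ext z
    simp only [besselIOne, Function.comp_apply]
    ring
  rw [heq, besselI_zero_eq]
  exact h.congr_deriv (by push_cast; ring)

lemma hasDerivAt_mul_coshMoment_one {x : ℝ} (hx : 0 < x) :
    HasDerivAt (fun x => x * coshMoment 1 x) (-(x * coshMoment 0 x)) x :=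
  ((hasDerivAt_id x).mul (hasDerivAt_coshMoment 1 hx)).congr_deriv (by
    simp only [id]
    linarith [coshMoment_ode hx])

lemma besselI_zero_zero : besselI 0 0 = 1 := by
  rw [besselI_zero_eq, besselSeries, tsum_eq_single 0 fun n hn => by simp [hn]]
  simp

lemma tendsto_besselI_zero : Tendsto (besselI 0) (nhdsWithin 0 (Ioi 0)) (nhds 1) := by
  have h := (hasDerivAt_besselI_zero 0).continuousAt.tendsto
  rw [besselI_zero_zero] at h
  exact h.mono_left nhdsWithin_le_nhds

lemma tendsto_besselIOne : Tendsto besselIOne (nhdsWithin 0 (Ioi 0)) (nhds 0) := by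
  have h := hasDerivAt_iff_tendsto_slope_zero.1 (hasDerivAt_mul_besselIOne 0)
  rw [zero_mul (besselI 0 0)] at h
  refine (h.mono_left (nhdsWithin_mono 0 fun x hx => (mem_Ioi.1 hx).ne')).congr' ?_
  filter_upwards [self_mem_nhdsWithin] with x hx
  have hx : x ≠ 0 := (mem_Ioi.1 hx).ne'
  simp [hx]

lemma tendsto_mul_coshMoment_zero_mul {f : ℝ → ℝ}
    (hf : Tendsto f (nhdsWithin 0 (Ioi 0)) (nhds 0)) :
    Tendsto (fun x => f x * (x * coshMoment 0 x)) (nhdsWithin 0 (Ioi 0)) (nhds 0) := by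
  have h := hf.norm.mul tendsto_mul_coshMoment_one
  rw [norm_zero, zero_mul] at h
  refine squeeze_zero_norm' ?_ h
  filter_upwards [self_mem_nhdsWithin] with x hx
  have hx : 0 < x := hx
  have := coshMoment_pos 0 hx
  have := coshMoment_zero_le_one hx
  rw [norm_mul, Real.norm_of_nonneg (r := x * _) (by positivity)]
  gcongr

/-- The Wronskian identity for `I₀` and `K₀`. -/
lemma besselIOne_mul_add {x : ℝ} (hx : 0 < x) :
    besselIOne x * coshMoment 0 x + besselI 0 x * coshMoment 1 x = 1 / x := by
  set W : ℝ → ℝ := fun x =>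
    x * besselIOne x * coshMoment 0 x + besselI 0 x * (x * coshMoment 1 x)
  have hW : ∀ y ∈ Ioi (0 : ℝ), HasDerivAt W 0 y := fun y hy =>
    (((hasDerivAt_mul_besselIOne y).mul (hasDerivAt_coshMoment 0 hy)).add
      ((hasDerivAt_besselI_zero y).mul (hasDerivAt_mul_coshMoment_one hy))).congr_deriv (by ring)
  have hconst : ∀ y ∈ Ioi (0 : ℝ), W y = W x := fun y hy =>
    isOpen_Ioi.is_const_of_deriv_eq_zero isPreconnected_Ioi
      (fun z hz => (hW z hz).differentiableAt.differentiableWithinAt)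
      (fun z hz => (hW z hz).deriv) hy hx
  have h1 : Tendsto W (nhdsWithin 0 (Ioi 0)) (nhds 1) := by
    have := (tendsto_mul_coshMoment_zero_mul tendsto_besselIOne).add
      (tendsto_besselI_zero.mul tendsto_mul_coshMoment_one)
    rw [zero_add, one_mul] at this
    exact this.congr fun y => by simp only [W]; ring
  have h2 : Tendsto W (nhdsWithin 0 (Ioi 0)) (nhds (W x)) :=
    tendsto_const_nhds.congr' (by
      filter_upwards [self_mem_nhdsWithin] with y hy using (hconst y hy).symm)
  have h3 : W x = 1 := tendsto_nhds_unique h2 h1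
  rw [eq_div_iff hx.ne', ← h3]
  simp only [W]
  ring

lemma strictMonoOn_besselI_mul_besselK_add_log :
    StrictMonoOn (fun x => besselI 0 x * besselK 0 x + Real.log x) (Ioi 0) := by
  rw [funext besselK_zero_eq]
  have hd : ∀ x ∈ Ioi (0 : ℝ), HasDerivAt (fun x => besselI 0 x * coshMoment 0 x + Real.log x)
      (2 * (besselIOne x * coshMoment 0 x)) x := fun x hx => by
    refine (((hasDerivAt_besselI_zero x).mul (hasDerivAt_coshMoment 0 hx)).add
      (Real.hasDerivAt_log (mem_Ioi.1 hx).ne')).congr_deriv ?_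
    rw [← one_div, ← besselIOne_mul_add hx]
    ring
  refine strictMonoOn_of_deriv_pos (convex_Ioi 0)
    (fun x hx => (hd x hx).continuousAt.continuousWithinAt) fun x hx => ?_
  rw [interior_Ioi] at hx
  rw [(hd x hx).deriv]
  have := mem_Ioi.1 hx
  have := coshMoment_pos 0 hx
  have := besselSeries_pos 1 (y := x ^ 2 / 4) (by positivity)
  unfold besselIOne
  positivity

lemma tendsto_besselI_mul_besselK_add_log :
    Tendsto (fun x => besselI 0 x * besselK 0 x + Real.log x) (nhdsWithin 0 (Ioi 0))
      (nhds (Real.log 2 - Real.eulerMascheroniConstant)) := by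
  rw [funext besselK_zero_eq]
  have h := hasDerivAt_iff_tendsto_slope_zero.1 (hasDerivAt_besselI_zero 0)
  have h1 : besselIOne 0 = 0 := by simp [besselIOne]
  rw [besselI_zero_zero, h1] at h
  have h2 := tendsto_mul_coshMoment_zero_mul
    (h.mono_left (nhdsWithin_mono 0 fun x hx => (mem_Ioi.1 hx).ne'))
  have h3 := h2.add tendsto_coshMoment_zero_add_log
  rw [zero_add] at h3
  refine h3.congr' ?_
  filter_upwards [self_mem_nhdsWithin] with x hx
  have hx : x ≠ 0 := (mem_Ioi.1 hx).ne'
  simp only [zero_add, smul_eq_mul]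
  field_simp
  ring

theorem stmt9 :
    (∀ x ∈ Ioc (0 : ℝ) 1,
        Real.log 2 - Real.eulerMascheroniConstant < besselI 0 x * besselK 0 x + Real.log x ∧
        besselI 0 x * besselK 0 x + Real.log x ≤ besselI 0 1 * besselK 0 1) ∧
    Filter.Tendsto (fun x : ℝ => besselI 0 x * besselK 0 x + Real.log x)
      (nhdsWithin 0 (Ioi 0)) (nhds (Real.log 2 - Real.eulerMascheroniConstant)) ∧
    besselI 0 1 * besselK 0 1 + Real.log 1 = besselI 0 1 * besselK 0 1 := by
  have hm := strictMonoOn_besselI_mul_besselK_add_log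
  have ht := tendsto_besselI_mul_besselK_add_log
  refine ⟨fun x hx => ⟨?_, ?_⟩, ht, by simp⟩
  · have h2 : 0 < x / 2 := half_pos hx.1
    refine lt_of_le_of_lt (le_of_tendsto ht ?_) (hm h2 hx.1 (half_lt_self hx.1))
    filter_upwards [Ioc_mem_nhdsGT h2] with y hy using hm.monotoneOn hy.1 h2 hy.2
  · simpa using hm.monotoneOn hx.1 (mem_Ioi.2 one_pos) hx.2
end
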